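/- arXiv:1504.05665 — 3 statements merged into one kernel-verified Lean document; each statement's English description precedes it below -/
import Mathlib

section
/- Let d ≥ 1 and let f : ℝ^d → ℝ be a concave function that is twice continuously differentiable on a neighborhood of a point θ̂, such that θ̂ is the unique global maximizer of f and the Hessian matrix H of f at θ̂ is negative definite. Let π : ℝ^d → ℝ be a continuous nonnegative function with π(θ̂) > 0 such that θ ↦ exp(f(θ))·π(θ) is integrable over ℝ^d. Then the sequence N ↦ N^{d/2} · ∫_{ℝ^d} exp(N·(f(θ) − f(θ̂)))·π(θ) dθ converges, as N → ∞ over the natural numbers, to (2π)^{d/2} · π(θ̂) · (det(−H))^{−1/2}. -/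
open MeasureTheory Filter Topology

/-- Second-order Taylor expansion with Peano remainder in a normed space. -/
theorem taylor_two_isLittleO {E F : Type*} [NormedAddCommGroup E] [NormedSpace ℝ E]
    [NormedAddCommGroup F] [NormedSpace ℝ F] {f : E → F} {x₀ : E} (hf : ContDiffAt ℝ 2 f x₀) :
    (fun h => f (x₀ + h) - f x₀ - fderiv ℝ f x₀ h
      - (2⁻¹ : ℝ) • fderiv ℝ (fderiv ℝ f) x₀ h h) =o[𝓝 0] fun h => ‖h‖ ^ 2 := by
  set B := fderiv ℝ (fderiv ℝ f) x₀ with hB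
  have hsymm : ∀ v w, B v w = B w v := hf.isSymmSndFDerivAt (by simp)
  have hder : HasFDerivAt (fderiv ℝ f) B x₀ :=
    ((hf.fderiv_right (m := 1) (by norm_num)).differentiableAt (by norm_num)).hasFDerivAt
  have hdiff : ∀ᶠ x in 𝓝 x₀, DifferentiableAt ℝ f x :=
    (hf.eventually (by simp)).mono fun x hx => hx.differentiableAt (by norm_num)
  refine Asymptotics.isLittleO_iff.2 fun c hc => ?_
  obtain ⟨ε, hε, hball⟩ := Metric.eventually_nhds_iff.1
    (hdiff.and (Asymptotics.isLittleO_iff.1 hder.isLittleO hc))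
  filter_upwards [Metric.ball_mem_nhds (0 : E) hε] with h hh
  have hlt : ‖h‖ < ε := by simpa using hh
  let R : E → F := fun k => f (x₀ + k) - f x₀ - fderiv ℝ f x₀ k - (2⁻¹ : ℝ) • B k k
  have hR : ∀ k ∈ Metric.closedBall (0 : E) ‖h‖,
      HasFDerivWithinAt R (fderiv ℝ f (x₀ + k) - fderiv ℝ f x₀ - B k)
        (Metric.closedBall 0 ‖h‖) k := by
    intro k hk
    have hk' : dist (x₀ + k) x₀ < ε := by
      simpa using (mem_closedBall_zero_iff.1 hk).trans_lt hlt
    have h1 : HasFDerivAt (fun k => f (x₀ + k)) (fderiv ℝ f (x₀ + k)) k :=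
      (hasFDerivAt_comp_add_left x₀).2 (hball hk').1.hasFDerivAt
    have h2 : HasFDerivAt (fun k => B k k) ((2 : ℝ) • B k) k := by
      convert! (B.hasFDerivAt (x := k)).clm_apply (hasFDerivAt_id k) using 1
      refine ContinuousLinearMap.ext fun v => ?_
      simp [two_smul, hsymm v k]
    have h3 := ((h1.sub_const (f x₀)).sub (fderiv ℝ f x₀).hasFDerivAt).sub
      (h2.const_smul (2⁻¹ : ℝ))
    rw [smul_smul, inv_mul_cancel₀ two_ne_zero, one_smul] at h3
    exact h3.hasFDerivWithinAt
  have hbound : ∀ k ∈ Metric.closedBall (0 : E) ‖h‖,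
      ‖fderiv ℝ f (x₀ + k) - fderiv ℝ f x₀ - B k‖ ≤ c * ‖h‖ := by
    intro k hk
    have hkh := mem_closedBall_zero_iff.1 hk
    have hk' : dist (x₀ + k) x₀ < ε := by simpa using hkh.trans_lt hlt
    have := (hball hk').2
    rw [add_sub_cancel_left] at this
    exact this.trans (by gcongr)
  have := (convex_closedBall (0 : E) ‖h‖).norm_image_sub_le_of_norm_hasFDerivWithin_le hR hbound
    (x := 0) (y := h) (by simp) (by simp)
  have hR0 : R 0 = 0 := by simp [R]
  rw [hR0, sub_zero, sub_zero] at this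
  simpa [R, pow_two, mul_assoc] using this

open scoped MatrixOrder in
theorem Matrix.PosDef.exists_transpose_mul_self {ι : Type*} [Fintype ι] [DecidableEq ι]
    {A : Matrix ι ι ℝ} (hA : A.PosDef) : ∃ B : Matrix ι ι ℝ, B.det ≠ 0 ∧ A = B.transpose * B := by
  obtain ⟨B, hB⟩ := CStarAlgebra.nonneg_iff_eq_star_mul_self.1 hA.posSemidef.nonneg
  rw [Matrix.star_eq_conjTranspose, Matrix.conjTranspose_eq_transpose_of_trivial] at hB
  refine ⟨B, fun h => ?_, hB⟩
  have := hA.det_pos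
  simp [hB, h] at this

theorem Matrix.dotProduct_transpose_mul_self_mulVec {ι R : Type*} [Fintype ι] [CommRing R]
    (B : Matrix ι ι R) (x : ι → R) :
    x ⬝ᵥ (B.transpose * B).mulVec x = ∑ i, B.mulVec x i ^ 2 := by
  rw [← Matrix.mulVec_mulVec, Matrix.dotProduct_mulVec, Matrix.vecMul_transpose]
  simp [dotProduct, pow_two]

theorem Matrix.PosDef.exists_mul_sq_norm_le {ι : Type*} [Fintype ι] [DecidableEq ι]
    {A : Matrix ι ι ℝ} (hA : A.PosDef) :
    ∃ c > 0, ∀ x : ι → ℝ, c * ‖x‖ ^ 2 ≤ x ⬝ᵥ A.mulVec x := by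
  obtain ⟨B, hB, rfl⟩ := hA.exists_transpose_mul_self
  let L : (ι → ℝ) →L[ℝ] (ι → ℝ) := LinearMap.toContinuousLinearMap (Matrix.toLin' B⁻¹)
  refine ⟨((‖L‖ + 1) ^ 2)⁻¹, by positivity, fun x => ?_⟩
  have h1 : L (B.mulVec x) = x := by
    simp [L, Matrix.mulVec_mulVec, Matrix.nonsing_inv_mul B (isUnit_iff_ne_zero.2 hB)]
  have h2 : ‖x‖ ≤ (‖L‖ + 1) * ‖B.mulVec x‖ := by
    calc ‖x‖ = ‖L (B.mulVec x)‖ := by rw [h1]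
      _ ≤ ‖L‖ * ‖B.mulVec x‖ := L.le_opNorm _
      _ ≤ _ := by gcongr; linarith
  have h3 : ‖B.mulVec x‖ ^ 2 ≤ ∑ i, B.mulVec x i ^ 2 := by
    refine (Real.le_sqrt (norm_nonneg _) (by positivity)).1
      ((pi_norm_le_iff_of_nonneg (Real.sqrt_nonneg _)).2 fun i => ?_)
    exact Real.abs_le_sqrt (Finset.single_le_sum (f := fun i => B.mulVec x i ^ 2)
      (fun i _ => sq_nonneg _) (Finset.mem_univ i))
  rw [Matrix.dotProduct_transpose_mul_self_mulVec, inv_mul_le_iff₀ (by positivity)]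
  calc ‖x‖ ^ 2 ≤ ((‖L‖ + 1) * ‖B.mulVec x‖) ^ 2 := by gcongr
    _ = (‖L‖ + 1) ^ 2 * ‖B.mulVec x‖ ^ 2 := mul_pow _ _ _
    _ ≤ _ := by gcongr

theorem integral_exp_neg_half_dotProduct_mulVec {ι : Type*} [Fintype ι] [DecidableEq ι]
    {A : Matrix ι ι ℝ} (hA : A.PosDef) :
    ∫ x : ι → ℝ, Real.exp (-(x ⬝ᵥ A.mulVec x) / 2) =
      (2 * Real.pi) ^ ((Fintype.card ι : ℝ) / 2) * A.det ^ (-(1 : ℝ) / 2) := by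
  obtain ⟨B, hB, rfl⟩ := hA.exists_transpose_mul_self
  have hstd : ∫ y : ι → ℝ, Real.exp (-(∑ i, y i ^ 2) / 2) =
      (2 * Real.pi) ^ ((Fintype.card ι : ℝ) / 2) := by
    have : ∀ y : ι → ℝ, Real.exp (-(∑ i, y i ^ 2) / 2) =
        ∏ i, Real.exp (-(1 / 2) * y i ^ 2) := by
      intro y
      rw [← Real.exp_sum, ← Finset.mul_sum]
      ring_nf
    simp_rw [this]
    rw [integral_fintype_prod_volume_eq_pow (fun t : ℝ => Real.exp (-(1 / 2) * t ^ 2)),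
      integral_gaussian, Real.sqrt_eq_rpow, ← Real.rpow_natCast, ← Real.rpow_mul (by positivity)]
    ring_nf
  have hchange : ∫ x : ι → ℝ, Real.exp (-(∑ i, B.mulVec x i ^ 2) / 2) =
      |B.det⁻¹| * ∫ y : ι → ℝ, Real.exp (-(∑ i, y i ^ 2) / 2) := by
    have := integral_map (μ := (volume : Measure (ι → ℝ))) (φ := Matrix.toLin' B)
      (f := fun y : ι → ℝ => Real.exp (-(∑ i, y i ^ 2) / 2))
      (LinearMap.continuous_of_finiteDimensional _).aemeasurable
      (Continuous.aestronglyMeasurable (by fun_prop))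
    rw [Real.map_matrix_volume_pi_eq_smul_volume_pi hB, integral_smul_measure,
      ENNReal.toReal_ofReal (abs_nonneg _)] at this
    simpa using this.symm
  simp_rw [Matrix.dotProduct_transpose_mul_self_mulVec]
  rw [hchange, hstd, Matrix.det_mul, Matrix.det_transpose, mul_comm, ← pow_two, ← sq_abs,
    ← Real.rpow_natCast, ← Real.rpow_mul (abs_nonneg _), abs_inv, ← Real.rpow_neg_one]
  norm_num

theorem integrable_exp_neg_half_dotProduct_mulVec {ι : Type*} [Fintype ι] [DecidableEq ι]
    {A : Matrix ι ι ℝ} (hA : A.PosDef) :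
    Integrable fun x : ι → ℝ => Real.exp (-(x ⬝ᵥ A.mulVec x) / 2) := by
  by_contra h
  have := integral_exp_neg_half_dotProduct_mulVec hA
  rw [integral_undef h] at this
  have := hA.det_pos
  have : 0 < (2 * Real.pi) ^ ((Fintype.card ι : ℝ) / 2) * A.det ^ (-(1 : ℝ) / 2) := by positivity
  linarith

theorem ConcaveOn.le_neg_of_le_on_closedBall {E : Type*} [NormedAddCommGroup E] [NormedSpace ℝ E]
    {g : E → ℝ} (hg : ConcaveOn ℝ Set.univ g) (h0 : g 0 = 0) {c δ : ℝ} (hc : 0 < c) (hδ : 0 < δ)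
    (hle : ∀ x, ‖x‖ ≤ δ → g x ≤ -c * ‖x‖ ^ 2) {x : E} (hx : δ ≤ ‖x‖) : g x ≤ -(c * δ ^ 2) := by
  have hxpos : 0 < ‖x‖ := hδ.trans_le hx
  set t := δ / ‖x‖ with ht
  have htpos : 0 < t := by positivity
  have ht1 : t ≤ 1 := (div_le_one hxpos).2 hx
  have hnorm : ‖t • x‖ = δ := by
    rw [norm_smul, Real.norm_of_nonneg htpos.le, ht, div_mul_cancel₀ _ hxpos.ne']
  have h1 : t * g x ≤ g (t • x) := by
    simpa [h0] using hg.2 (Set.mem_univ x) (Set.mem_univ 0) htpos.le (sub_nonneg.2 ht1)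
      (add_sub_cancel t 1)
  have h2 := hle (t • x) hnorm.le
  rw [hnorm] at h2
  have h3 : 0 < c * δ ^ 2 := by positivity
  by_contra! hlt
  nlinarith

/-- The integral away from the maximum is exponentially small. -/
theorem tendsto_rpow_mul_setIntegral_exp_of_le_neg {E : Type*} [MeasurableSpace E] {μ : Measure E}
    {g p : E → ℝ} {s : Set E} {η : ℝ} (hs : MeasurableSet s) (hη : 0 < η)
    (hle : ∀ x ∈ s, g x ≤ -η) (hp : ∀ x, 0 ≤ p x)
    (hint : Integrable (fun x => Real.exp (g x) * p x) μ) (a : ℝ) :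
    Tendsto (fun N : ℕ => (N : ℝ) ^ a * ∫ x in s, Real.exp (N * g x) * p x ∂μ)
      atTop (𝓝 0) := by
  set I := ∫ x in s, Real.exp (g x) * p x ∂μ
  have hlim : Tendsto (fun N : ℕ => (N : ℝ) ^ a * Real.exp (-η * N) * (Real.exp η * I))
      atTop (𝓝 0) := by
    simpa using ((tendsto_rpow_mul_exp_neg_mul_atTop_nhds_zero a η hη).comp
      tendsto_natCast_atTop_atTop).mul_const (Real.exp η * I)
  refine squeeze_zero' (Eventually.of_forall fun N => ?_) ?_ hlim
  · exact mul_nonneg (by positivity)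
      (integral_nonneg fun x => mul_nonneg (Real.exp_nonneg _) (hp x))
  · filter_upwards [eventually_ge_atTop 1] with N hN
    have hN' : (1 : ℝ) ≤ N := by exact_mod_cast hN
    rw [mul_assoc]
    refine mul_le_mul_of_nonneg_left ?_ (by positivity)
    rw [← mul_assoc, ← integral_const_mul]
    refine integral_mono_of_nonneg
      (Eventually.of_forall fun x => mul_nonneg (Real.exp_nonneg _) (hp x))
      (hint.integrableOn.const_mul _) ?_
    filter_upwards [ae_restrict_mem hs] with x hx
    rw [← mul_assoc, ← Real.exp_add, ← Real.exp_add]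
    refine mul_le_mul_of_nonneg_right (Real.exp_le_exp.2 ?_) (hp x)
    nlinarith [hle x hx]

/-- Laplace's method for a concave exponent with maximum `0` at the origin. -/
theorem tendsto_rpow_mul_integral_exp_of_isLittleO {ι : Type*} [Fintype ι] [DecidableEq ι]
    {g p : (ι → ℝ) → ℝ} {A : Matrix ι ι ℝ} (hA : A.PosDef) (hg : ConcaveOn ℝ Set.univ g)
    (h0 : g 0 = 0)
    (hexp : (fun x => g x + 2⁻¹ * (x ⬝ᵥ A.mulVec x)) =o[𝓝 0] fun x => ‖x‖ ^ 2)
    (hp : Continuous p) (hp0 : ∀ x, 0 ≤ p x)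
    (hint : Integrable fun x => Real.exp (g x) * p x) :
    Tendsto (fun N : ℕ => (N : ℝ) ^ ((Fintype.card ι : ℝ) / 2) * ∫ x, Real.exp (N * g x) * p x)
      atTop (𝓝 ((2 * Real.pi) ^ ((Fintype.card ι : ℝ) / 2) * p 0 * A.det ^ (-(1 : ℝ) / 2))) := by
  have hgc : Continuous g := hg.locallyLipschitz.continuous
  obtain ⟨c, hc, hcoer⟩ := hA.exists_mul_sq_norm_le
  have hquad : ∀ᶠ x in 𝓝 (0 : ι → ℝ), g x ≤ -((2⁻¹ : ℝ) • (x ⬝ᵥ A.mulVec x)) / 2 := by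
    filter_upwards [Asymptotics.isLittleO_iff.1 hexp (show 0 < c / 4 by positivity)] with x hx
    have h1 := (le_abs_self _).trans hx
    rw [Real.norm_of_nonneg (by positivity)] at h1
    have h2 := hcoer x
    simp only [smul_eq_mul]
    linarith
  have hpb : ∀ᶠ x in 𝓝 (0 : ι → ℝ), p x ≤ p 0 + 1 :=
    (hp.tendsto 0).eventually_le_const (by linarith)
  obtain ⟨δ, hδ, hball⟩ := Metric.nhds_basis_closedBall.eventually_iff.1 (hquad.and hpb)
  have hfar : ∀ x ∈ (Metric.ball (0 : ι → ℝ) δ)ᶜ, g x ≤ -(c / 4 * δ ^ 2) := by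
    intro x hx
    refine hg.le_neg_of_le_on_closedBall h0 (by positivity) hδ (fun y hy => ?_) (by simpa using hx)
    have h1 := (hball (mem_closedBall_zero_iff.2 hy)).1
    have h2 := hcoer y
    simp only [smul_eq_mul] at h1
    linarith
  have hgnonpos : ∀ x, g x ≤ 0 := by
    intro x
    by_cases hx : x ∈ Metric.ball (0 : ι → ℝ) δ
    · have h1 := (hball (Metric.ball_subset_closedBall hx)).1
      have h2 := (mul_nonneg hc.le (sq_nonneg ‖x‖)).trans (hcoer x)
      simp only [smul_eq_mul] at h1
      linarith
    · have : 0 < c / 4 * δ ^ 2 := by positivity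
      linarith [hfar x hx]
  have hintN : ∀ N : ℕ, 1 ≤ N → Integrable fun x => Real.exp (N * g x) * p x := by
    intro N hN
    have hN' : (1 : ℝ) ≤ N := by exact_mod_cast hN
    refine hint.mono' (Continuous.aestronglyMeasurable (by fun_prop))
      (Eventually.of_forall fun x => ?_)
    rw [Real.norm_of_nonneg (mul_nonneg (Real.exp_nonneg _) (hp0 x))]
    refine mul_le_mul_of_nonneg_right (Real.exp_le_exp.2 ?_) (hp0 x)
    nlinarith [hgnonpos x]
  have hnear : Tendsto (fun N : ℕ => (N : ℝ) ^ ((Fintype.card ι : ℝ) / 2) *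
      ∫ x in Metric.ball 0 δ, Real.exp (N * g x) * p x) atTop
      (𝓝 ((2 * Real.pi) ^ ((Fintype.card ι : ℝ) / 2) * p 0 * A.det ^ (-(1 : ℝ) / 2))) := by
    have hscale : ∀ N : ℕ, (N : ℝ) ^ ((Fintype.card ι : ℝ) / 2) *
        ∫ x in Metric.ball 0 δ, Real.exp (N * g x) * p x =
        ∫ y, (Metric.ball 0 δ).indicator (fun x => Real.exp (N * g x) * p x)
          ((√(N : ℝ))⁻¹ • y) := by
      intro N
      rw [Measure.integral_comp_inv_smul_of_nonneg _ _ (Real.sqrt_nonneg _),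
        integral_indicator measurableSet_ball, Module.finrank_fintype_fun_eq_card, smul_eq_mul,
        Real.sqrt_eq_rpow, ← Real.rpow_natCast, ← Real.rpow_mul (by positivity)]
      ring_nf
    have hlimit : ∫ y : ι → ℝ, Real.exp (-(y ⬝ᵥ A.mulVec y) / 2) * p 0 =
        (2 * Real.pi) ^ ((Fintype.card ι : ℝ) / 2) * p 0 * A.det ^ (-(1 : ℝ) / 2) := by
      rw [integral_mul_const, integral_exp_neg_half_dotProduct_mulVec hA]
      ring
    have hsqrt : Tendsto (fun N : ℕ => (√(N : ℝ))⁻¹) atTop (𝓝 0) :=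
      tendsto_inv_atTop_zero.comp (Real.tendsto_sqrt_atTop.comp tendsto_natCast_atTop_atTop)
    have hsq : ∀ N : ℕ, 1 ≤ N → (N : ℝ) * ((√(N : ℝ))⁻¹ * (√(N : ℝ))⁻¹) = 1 := by
      intro N hN
      have : (N : ℝ) ≠ 0 := by positivity
      rw [← mul_inv, Real.mul_self_sqrt (by positivity), mul_inv_cancel₀ this]
    have hQ : ∀ (t : ℝ) (y : ι → ℝ),
        (t • y) ⬝ᵥ A.mulVec (t • y) = (t * t) * (y ⬝ᵥ A.mulVec y) := by
      intro t y
      simp [Matrix.mulVec_smul, mul_assoc]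
    simp_rw [hscale, ← hlimit]
    refine tendsto_integral_filter_of_dominated_convergence
      (fun y => Real.exp (-(y ⬝ᵥ ((2⁻¹ : ℝ) • A).mulVec y) / 2) * (p 0 + 1)) ?_ ?_ ?_ ?_
    · refine Eventually.of_forall fun N => Measurable.aestronglyMeasurable ?_
      exact (Measurable.indicator (Continuous.measurable (by fun_prop))
        measurableSet_ball).comp (measurable_const_smul _)
    · filter_upwards [eventually_ge_atTop 1] with N hN
      refine Eventually.of_forall fun y => ?_
      by_cases hy : (√(N : ℝ))⁻¹ • y ∈ Metric.ball (0 : ι → ℝ) δ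
      · obtain ⟨h1, h2⟩ := hball (Metric.ball_subset_closedBall hy)
        rw [Set.indicator_of_mem hy,
          Real.norm_of_nonneg (mul_nonneg (Real.exp_nonneg _) (hp0 _))]
        refine mul_le_mul (Real.exp_le_exp.2 ?_) h2 (hp0 _) (Real.exp_nonneg _)
        rw [hQ] at h1
        calc _ ≤ (N : ℝ) * _ := mul_le_mul_of_nonneg_left h1 N.cast_nonneg
          _ = -(2⁻¹ * ((N : ℝ) * ((√(N : ℝ))⁻¹ * (√(N : ℝ))⁻¹) * (y ⬝ᵥ A.mulVec y))) / 2 := by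
            simp only [smul_eq_mul]
            ring
          _ = _ := by rw [hsq N hN]; simp [Matrix.smul_mulVec]
      · rw [Set.indicator_of_notMem hy, norm_zero]
        have := hp0 0
        positivity
    · exact (integrable_exp_neg_half_dotProduct_mulVec (hA.smul (by norm_num))).mul_const _
    · refine Eventually.of_forall fun y => ?_
      have hy0 : Tendsto (fun N : ℕ => (√(N : ℝ))⁻¹ • y) atTop (𝓝 0) := by
        simpa using hsqrt.smul_const y
      have hexpo : Tendsto (fun N : ℕ => (N : ℝ) * g ((√(N : ℝ))⁻¹ • y)) atTop
          (𝓝 (-(y ⬝ᵥ A.mulVec y) / 2)) := by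
        have h1 := (((hexp.tendsto_div_nhds_zero.comp hy0).mul_const (‖y‖ ^ 2)).add_const
          (-(y ⬝ᵥ A.mulVec y) / 2))
        rw [zero_mul, zero_add] at h1
        refine h1.congr' ?_
        filter_upwards [eventually_ge_atTop 1] with N hN
        rcases eq_or_ne y 0 with rfl | hy
        · simp [h0]
        · have hs : (√(N : ℝ)) ≠ 0 := by positivity
          have hyn : ‖y‖ ≠ 0 := norm_ne_zero_iff.2 hy
          have hNs : (N : ℝ) = √(N : ℝ) ^ 2 := (Real.sq_sqrt N.cast_nonneg).symm
          simp only [Function.comp_apply, hQ, norm_smul, norm_inv,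
            Real.norm_of_nonneg (Real.sqrt_nonneg (N : ℝ))]
          generalize g ((√(N : ℝ))⁻¹ • y) = G
          rw [hNs, Real.sqrt_sq (Real.sqrt_nonneg _)]
          field_simp
          ring
      have hmain := ((Real.continuous_exp.tendsto _).comp hexpo).mul ((hp.tendsto 0).comp hy0)
      refine hmain.congr' ?_
      filter_upwards [hy0.eventually (Metric.ball_mem_nhds 0 hδ)] with N hN
      have hmem : (√(N : ℝ))⁻¹ • y ∈ Metric.ball (0 : ι → ℝ) δ := hN
      rw [Set.indicator_of_mem hmem]
      rfl
  have hsum := hnear.add (tendsto_rpow_mul_setIntegral_exp_of_le_neg (μ := volume)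
    measurableSet_ball.compl (by positivity) hfar hp0 hint ((Fintype.card ι : ℝ) / 2))
  rw [add_zero] at hsum
  refine hsum.congr' ?_
  filter_upwards [eventually_ge_atTop 1] with N hN
  rw [← mul_add, integral_add_compl measurableSet_ball (hintN N hN)]

/-- **Multivariate Laplace approximation** (Lemma 1).
Let `f : ℝ^d → ℝ` be concave, C² near its unique global maximizer `θ̂`, with
negative definite Hessian `H` at `θ̂` (encoded as `(-H).PosDef`), and let
`prior` be a continuous nonnegative function, positive at `θ̂`, with
`exp (f θ) * prior θ` integrable.  Then
`N^(d/2) * ∫ exp (N (f θ - f θ̂)) prior θ dθ → (2π)^(d/2) * prior θ̂ * det(-H)^(-1/2)`. -/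
theorem laplace_method
    (d : ℕ) (hd : 1 ≤ d)
    (f : (Fin d → ℝ) → ℝ) (θhat : Fin d → ℝ)
    (hconc : ConcaveOn ℝ Set.univ f)
    (hsmooth : ContDiffAt ℝ 2 f θhat)
    (hmax : ∀ θ : Fin d → ℝ, θ ≠ θhat → f θ < f θhat)
    (H : Matrix (Fin d) (Fin d) ℝ)
    (hH : ∀ i j : Fin d,
      H i j = iteratedFDeriv ℝ 2 f θhat ![Pi.single i (1 : ℝ), Pi.single j (1 : ℝ)])
    (hneg : (-H).PosDef)
    (prior : (Fin d → ℝ) → ℝ)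
    (hcont : Continuous prior) (hnonneg : ∀ θ, 0 ≤ prior θ)
    (hpos : 0 < prior θhat)
    (hint : Integrable (fun θ => Real.exp (f θ) * prior θ) volume) :
    Tendsto
      (fun N : ℕ =>
        (N : ℝ) ^ ((d : ℝ) / 2) *
          ∫ θ : Fin d → ℝ, Real.exp ((N : ℝ) * (f θ - f θhat)) * prior θ)
      atTop
      (𝓝 ((2 * Real.pi) ^ ((d : ℝ) / 2) * prior θhat *
        ((-H).det) ^ (-(1 : ℝ) / 2))) := by
  have hmaxOn : IsLocalMax f θhat := Eventually.of_forall fun θ => by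
    rcases eq_or_ne θ θhat with rfl | h
    · exact le_rfl
    · exact (hmax θ h).le
  have hQ : ∀ x : Fin d → ℝ, fderiv ℝ (fderiv ℝ f) θhat x x = -(x ⬝ᵥ (-H).mulVec x) := by
    intro x
    have hx : ∑ i, x i • (Pi.single i (1 : ℝ) : Fin d → ℝ) = x := by
      simpa using (pi_eq_sum_univ' x).symm
    have hij : ∀ i j, H i j =
        fderiv ℝ (fderiv ℝ f) θhat (Pi.single i 1) (Pi.single j 1) := fun i j => by
      rw [hH, iteratedFDeriv_two_apply]
      rfl
    rw [Matrix.neg_mulVec, dotProduct_neg, neg_neg]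
    calc fderiv ℝ (fderiv ℝ f) θhat x x
        = fderiv ℝ (fderiv ℝ f) θhat (∑ i, x i • (Pi.single i (1 : ℝ) : Fin d → ℝ))
          (∑ j, x j • (Pi.single j (1 : ℝ) : Fin d → ℝ)) := by rw [hx]
      _ = ∑ i, ∑ j, x i * (H i j * x j) := by
        simp only [map_sum, map_smul, sum_apply, smul_apply, smul_eq_mul, hij, Finset.mul_sum]
        rw [Finset.sum_comm]
        refine Finset.sum_congr rfl fun i _ => Finset.sum_congr rfl fun j _ => ?_
        ring
      _ = x ⬝ᵥ H.mulVec x := by simp only [dotProduct, Matrix.mulVec, Finset.mul_sum]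
  have hexp : (fun x => (f (θhat + x) - f θhat) + 2⁻¹ * (x ⬝ᵥ (-H).mulVec x)) =o[𝓝 0]
      fun x => ‖x‖ ^ 2 := by
    refine (taylor_two_isLittleO hsmooth).congr_left fun x => ?_
    rw [hmaxOn.fderiv_eq_zero, hQ]
    simp
  have hconc' : ConcaveOn ℝ Set.univ fun x => f (θhat + x) - f θhat := by
    have := (hconc.translate_right θhat).add_const (-f θhat)
    rw [Set.preimage_univ] at this
    simpa only [sub_eq_add_neg] using! this
  have hint' : Integrable fun x => Real.exp (f (θhat + x) - f θhat) * prior (θhat + x) := by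
    refine ((hint.comp_add_left θhat).const_mul (Real.exp (-f θhat))).congr
      (Eventually.of_forall fun x => ?_)
    simp only [← mul_assoc, ← Real.exp_add]
    ring_nf
  have hlim := tendsto_rpow_mul_integral_exp_of_isLittleO (p := fun x => prior (θhat + x)) hneg
    hconc' (by simp) hexp (by fun_prop) (fun x => hnonneg _) hint'
  simp only [Fintype.card_fin, add_zero] at hlim
  refine hlim.congr fun N => ?_
  rw [integral_add_left_eq_self (fun θ => Real.exp (N * (f θ - f θhat)) * prior θ) θhat]
end

section
/- Let d ≥ 1 and let f : ℝ^d → ℝ be a concave function that is twice continuously differentiable on a neighborhood of a point θ̂, such that θ̂ is the unique global maximizer of f and the Hessian matrix H of f at θ̂ is negative definite. Let π : ℝ^d → ℝ be a continuous nonnegative function with π(θ̂) > 0 such that θ ↦ exp(f(θ))·π(θ) is integrable over ℝ^d. Then the sequence N ↦ log(∫_{ℝ^d} exp(N·f(θ))·π(θ) dθ) − N·f(θ̂) + (d/2)·log N converges, as N → ∞ over the natural numbers, to (d/2)·log(2π) + log π(θ̂) − (1/2)·log det(−H). In particular, log ∫ exp(N f) π dθ = N f(θ̂) − (d/2) log N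 + O(1). -/
open MeasureTheory Filter Topology

theorem isLittleO_second_order_taylor {E : Type*} [NormedAddCommGroup E] [NormedSpace ℝ E]
    {f : E → ℝ} {a : E} (hf : ContDiffAt ℝ 2 f a) (ha : fderiv ℝ f a = 0) :
    (fun x => f (a + x) - f a - (1 / 2) * fderiv ℝ (fderiv ℝ f) a x x)
      =o[𝓝 0] fun x => ‖x‖ ^ 2 := by
  have hd : HasFDerivAt (fderiv ℝ f) (fderiv ℝ (fderiv ℝ f) a) a :=
    ((hf.fderiv_right (m := 1) (by norm_num)).differentiableAt (by norm_num)).hasFDerivAt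
  set L := fderiv ℝ (fderiv ℝ f) a
  have hdiff : ∀ᶠ y in 𝓝 a, DifferentiableAt ℝ f y :=
    (hf.eventually (by simp)).mono fun y hy => hy.differentiableAt (by norm_num)
  have hshift : Tendsto (fun x => a + x) (𝓝 0) (𝓝 a) := by
    have h : Continuous fun x : E => a + x := by fun_prop
    simpa using h.tendsto 0
  rw [Asymptotics.isLittleO_iff]
  intro ε hε
  have hlin := (Asymptotics.isLittleO_iff.1 (hasFDerivAt_iff_isLittleO_nhds_zero.1 hd)) hε
  obtain ⟨r, hr, hball⟩ := Metric.eventually_nhds_iff_ball.1 (hlin.and (hshift.eventually hdiff))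
  filter_upwards [Metric.ball_mem_nhds 0 hr] with x hx
  have hmem : ∀ t ∈ Set.Icc (0 : ℝ) 1, t • x ∈ Metric.ball (0 : E) r := by
    intro t ht
    rw [mem_ball_zero_iff] at hx ⊢
    rw [norm_smul, Real.norm_of_nonneg ht.1]
    exact (mul_le_of_le_one_left (norm_nonneg x) ht.2).trans_lt hx
  have hderiv : ∀ t ∈ Set.Icc (0 : ℝ) 1,
      HasDerivAt (fun t : ℝ => f (a + t • x) - (1 / 2) * (t ^ 2 * L x x))
        (fderiv ℝ f (a + t • x) x - t * L x x) t := by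
    intro t ht
    have h1 : HasDerivAt (fun t : ℝ => a + t • x) x t := by
      simpa using ((hasDerivAt_id t).smul_const x).const_add a
    have h2 := (hball _ (hmem t ht)).2.hasFDerivAt.comp_hasDerivAt t h1
    have h3 := (((hasDerivAt_id t).pow 2).mul_const (L x x)).const_mul (1 / 2)
    refine (h2.sub h3).congr_deriv ?_
    simp
    ring
  have hbound := norm_image_sub_le_of_norm_deriv_le_segment_01' (C := ε * ‖x‖ ^ 2)
    (fun t ht => (hderiv t ht).hasDerivWithinAt) (fun t ht => by
      have ht' := Set.Ico_subset_Icc_self ht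
      have h := (hball _ (hmem t ht')).1
      rw [ha, sub_zero] at h
      have hx0 := norm_nonneg x
      calc ‖fderiv ℝ f (a + t • x) x - t * L x x‖
          = ‖(fderiv ℝ f (a + t • x) - L (t • x)) x‖ := by simp
        _ ≤ ‖fderiv ℝ f (a + t • x) - L (t • x)‖ * ‖x‖ := ContinuousLinearMap.le_opNorm _ _
        _ ≤ ε * ‖t • x‖ * ‖x‖ := by gcongr
        _ ≤ ε * (1 * ‖x‖) * ‖x‖ := by
          rw [norm_smul, Real.norm_of_nonneg ht.1]
          gcongr
          exact ht'.2
        _ = ε * ‖x‖ ^ 2 := by ring)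
  simpa [sub_right_comm] using hbound

theorem Matrix.integrable_and_integral_exp_neg_mul_dotProduct_mulVec {d : ℕ}
    (B : Matrix (Fin d) (Fin d) ℝ) (hB : B.det ≠ 0) {b : ℝ} (hb : 0 < b) :
    Integrable (fun u : Fin d → ℝ => Real.exp (-b * (B.mulVec u ⬝ᵥ B.mulVec u))) ∧
    ∫ u : Fin d → ℝ, Real.exp (-b * (B.mulVec u ⬝ᵥ B.mulVec u))
      = |B.det|⁻¹ * √(Real.pi / b) ^ d := by
  have hprod : (fun v : Fin d → ℝ => Real.exp (-b * (v ⬝ᵥ v)))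
      = fun v => ∏ i, Real.exp (-b * v i ^ 2) := by
    funext v
    rw [← Real.exp_sum, ← Finset.mul_sum]
    simp [dotProduct, pow_two]
  have hint : Integrable (fun v : Fin d → ℝ => Real.exp (-b * (v ⬝ᵥ v))) := by
    rw [hprod]
    exact Integrable.fintype_prod fun _ => integrable_exp_neg_mul_sq hb
  have hval : ∫ v : Fin d → ℝ, Real.exp (-b * (v ⬝ᵥ v)) = √(Real.pi / b) ^ d := by
    rw [hprod, integral_fintype_prod_volume_eq_pow (fun x : ℝ => Real.exp (-b * x ^ 2)),
      integral_gaussian, Fintype.card_fin]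
  have hmap := Real.map_matrix_volume_pi_eq_smul_volume_pi hB
  have hcont : Continuous (Matrix.toLin' B) := LinearMap.continuous_of_finiteDimensional _
  constructor
  · refine Integrable.comp_measurable (f := Matrix.toLin' B)
      (g := fun v => Real.exp (-b * (v ⬝ᵥ v))) ?_ hcont.measurable
    rw [hmap]
    exact hint.smul_measure ENNReal.ofReal_ne_top
  · have h := integral_map (μ := volume) hcont.aemeasurable
      (f := fun v : Fin d → ℝ => Real.exp (-b * (v ⬝ᵥ v)))
      (by rw [hmap]; exact (hint.smul_measure ENNReal.ofReal_ne_top).aestronglyMeasurable)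
    rw [hmap, integral_smul_measure, hval, ENNReal.toReal_ofReal (abs_nonneg _), abs_inv] at h
    simpa using h.symm

open scoped MatrixOrder Matrix in
theorem Matrix.PosDef.exists_eq_transpose_mul_self {d : ℕ} {A : Matrix (Fin d) (Fin d) ℝ}
    (hA : A.PosDef) : ∃ B : Matrix (Fin d) (Fin d) ℝ, A = Bᵀ * B ∧ B.det ≠ 0 := by
  obtain ⟨B, hB⟩ := CStarAlgebra.nonneg_iff_eq_star_mul_self.1 hA.posSemidef.nonneg
  refine ⟨B, hB, fun h => hA.det_pos.ne' ?_⟩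
  simp [hB, h]

theorem ConcaveOn.exists_forall_le_neg_of_le_norm {E : Type*} [NormedAddCommGroup E]
    [NormedSpace ℝ E] [ProperSpace E] {g : E → ℝ} (hg : ConcaveOn ℝ Set.univ g)
    (hgc : Continuous g) (h0 : g 0 = 0) (hneg : ∀ x, x ≠ 0 → g x < 0) {δ : ℝ} (hδ : 0 < δ) :
    ∃ c > 0, ∀ x, δ ≤ ‖x‖ → g x ≤ -c := by
  obtain ⟨c, hc, hsphere⟩ := (isCompact_sphere (0 : E) δ).exists_forall_le'
    (f := fun x => -g x) hgc.neg.continuousOn (a := 0) (fun x hx =>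
      neg_pos.2 (hneg x (by rintro rfl; simp at hx; exact hδ.ne hx)))
  refine ⟨c, hc, fun x hx => ?_⟩
  have hxpos : 0 < ‖x‖ := hδ.trans_le hx
  have ht0 : 0 ≤ δ / ‖x‖ := by positivity
  have ht1 : δ / ‖x‖ ≤ 1 := (div_le_one hxpos).2 hx
  have h1 := hsphere ((δ / ‖x‖) • x) (by
    rw [mem_sphere_zero_iff_norm, norm_smul, Real.norm_of_nonneg ht0,
      div_mul_cancel₀ _ hxpos.ne'])
  have h2 := hg.2 (Set.mem_univ x) (Set.mem_univ 0) ht0 (sub_nonneg.2 ht1) (by ring)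
  simp only [smul_eq_mul, smul_zero, add_zero, h0, mul_zero] at h2
  have hgx := hneg x (norm_pos_iff.1 hxpos)
  nlinarith

theorem tendsto_mul_comp_inv_sqrt_smul {E : Type*} [NormedAddCommGroup E] [NormedSpace ℝ E]
    {g q : E → ℝ} (hq : ∀ (t : ℝ) x, q (t • x) = t ^ 2 * q x)
    (hgq : (fun x => g x + q x) =o[𝓝 0] fun x => ‖x‖ ^ 2) (u : E) :
    Tendsto (fun N : ℕ => (N : ℝ) * g ((√(N : ℝ))⁻¹ • u)) atTop (𝓝 (-q u)) := by
  have hx : Tendsto (fun N : ℕ => (√(N : ℝ))⁻¹ • u) atTop (𝓝 0) := by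
    have h : Tendsto (fun N : ℕ => (√(N : ℝ))⁻¹) atTop (𝓝 0) :=
      (Real.tendsto_sqrt_atTop.comp tendsto_natCast_atTop_atTop).inv_tendsto_atTop
    simpa using h.smul_const u
  have hsmall := (Asymptotics.isBigO_refl (fun N : ℕ => (N : ℝ)) atTop).mul_isLittleO
    (hgq.comp_tendsto hx)
  have hbdd : (fun N : ℕ => (N : ℝ) * ‖(√(N : ℝ))⁻¹ • u‖ ^ 2) =O[atTop] fun _ => (1 : ℝ) := by
    refine Asymptotics.IsBigO.of_bound (‖u‖ ^ 2) ?_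
    filter_upwards [eventually_gt_atTop 0] with N hN
    have hN' : (0 : ℝ) < N := by exact_mod_cast hN
    rw [norm_smul, mul_pow, Real.norm_eq_abs (√(N : ℝ))⁻¹, sq_abs, inv_pow,
      Real.sq_sqrt hN'.le, mul_inv_cancel_left₀ hN'.ne']
    simp
  have hlim := ((Asymptotics.isLittleO_one_iff ℝ).1 (hsmall.trans_isBigO hbdd)).sub_const (q u)
  rw [zero_sub] at hlim
  refine hlim.congr' ?_
  filter_upwards [eventually_gt_atTop 0] with N hN
  have hN' : (0 : ℝ) < N := by exact_mod_cast hN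
  simp only [Function.comp, hq, inv_pow, Real.sq_sqrt hN'.le]
  rw [mul_add, mul_inv_cancel_left₀ hN'.ne', add_sub_cancel_right]

section Laplace

variable {E : Type*} [NormedAddCommGroup E] [MeasurableSpace E] [BorelSpace E] {μ : Measure E}

theorem tendsto_sqrt_pow_mul_setIntegral_compl_ball {g p : E → ℝ}
    (hp0 : ∀ x, 0 ≤ p x)
    (hint : Integrable (fun x => Real.exp (g x) * p x) μ) {δ c : ℝ} (hc : 0 < c)
    (hout : ∀ x, δ ≤ ‖x‖ → g x ≤ -c) (n : ℕ) :
    Tendsto (fun N : ℕ => √(N : ℝ) ^ n *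
      ∫ x in (Metric.ball 0 δ)ᶜ, Real.exp (N * g x) * p x ∂μ) atTop (𝓝 0) := by
  have hdecay : Tendsto (fun N : ℕ => (√(N : ℝ) ^ n * Real.exp (-c * N)) *
      (Real.exp c * ∫ x, Real.exp (g x) * p x ∂μ)) atTop (𝓝 0) := by
    have h := (tendsto_rpow_mul_exp_neg_mul_atTop_nhds_zero (n / 2 : ℝ) c hc).comp
      (tendsto_natCast_atTop_atTop (R := ℝ))
    rw [← zero_mul (Real.exp c * ∫ x, Real.exp (g x) * p x ∂μ)]
    refine Tendsto.mul_const _ (h.congr fun N => ?_)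
    simp only [Function.comp]
    rw [Real.sqrt_eq_rpow, ← Real.rpow_natCast, ← Real.rpow_mul (Nat.cast_nonneg N)]
    ring_nf
  have hmeas : MeasurableSet (Metric.ball (0 : E) δ)ᶜ := measurableSet_ball.compl
  refine squeeze_zero' (Eventually.of_forall fun N => ?_) ?_ hdecay
  · exact mul_nonneg (by positivity)
      (integral_nonneg fun x => mul_nonneg (Real.exp_nonneg _) (hp0 x))
  filter_upwards [eventually_ge_atTop 1] with N hN
  have hN' : (1 : ℝ) ≤ N := by exact_mod_cast hN
  rw [mul_assoc]
  gcongr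
  rw [← mul_assoc, ← integral_const_mul]
  calc ∫ x in (Metric.ball 0 δ)ᶜ, Real.exp (N * g x) * p x ∂μ
      ≤ ∫ x in (Metric.ball 0 δ)ᶜ,
          Real.exp (-c * N) * Real.exp c * (Real.exp (g x) * p x) ∂μ := by
        refine integral_mono_of_nonneg
          (Eventually.of_forall fun x => mul_nonneg (Real.exp_nonneg _) (hp0 x))
          (hint.const_mul _).integrableOn ?_
        filter_upwards [ae_restrict_mem hmeas] with x hx
        have hgx := hout x (by simpa using hx)
        rw [← mul_assoc, ← Real.exp_add, ← Real.exp_add]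
        have := hp0 x
        gcongr
        nlinarith
    _ ≤ ∫ x, Real.exp (-c * N) * Real.exp c * (Real.exp (g x) * p x) ∂μ :=
        setIntegral_le_integral (hint.const_mul _) (Eventually.of_forall fun x => by
          have := hp0 x
          positivity)

variable [NormedSpace ℝ E] [FiniteDimensional ℝ E] [μ.IsAddHaarMeasure]

theorem tendsto_sqrt_pow_mul_setIntegral_ball {g p q : E → ℝ}
    (hg : Continuous g) (hp : Continuous p)
    (hq : ∀ (t : ℝ) x, q (t • x) = t ^ 2 * q x)
    (hgq : (fun x => g x + q x) =o[𝓝 0] fun x => ‖x‖ ^ 2)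
    (hqint : Integrable (fun x => Real.exp (-(1 / 2) * q x)) μ) {δ M : ℝ} (hδ : 0 < δ)
    (hgle : ∀ x ∈ Metric.ball 0 δ, g x ≤ -(1 / 2) * q x)
    (hM : ∀ x ∈ Metric.ball 0 δ, ‖p x‖ ≤ M) :
    Tendsto (fun N : ℕ => √(N : ℝ) ^ Module.finrank ℝ E *
      ∫ x in Metric.ball 0 δ, Real.exp (N * g x) * p x ∂μ) atTop
      (𝓝 (∫ x, Real.exp (-q x) * p 0 ∂μ)) := by
  have hM0 : 0 ≤ M := (norm_nonneg _).trans (hM 0 (Metric.mem_ball_self hδ))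
  set F : ℕ → E → ℝ := fun N => (Metric.ball 0 δ).indicator fun x => Real.exp (N * g x) * p x
  have hx (u : E) : Tendsto (fun N : ℕ => (√(N : ℝ))⁻¹ • u) atTop (𝓝 0) := by
    have h : Tendsto (fun N : ℕ => (√(N : ℝ))⁻¹) atTop (𝓝 0) :=
      (Real.tendsto_sqrt_atTop.comp tendsto_natCast_atTop_atTop).inv_tendsto_atTop
    simpa using h.smul_const u
  have hscale : ∀ N : ℕ, √(N : ℝ) ^ Module.finrank ℝ E *
      ∫ x in Metric.ball 0 δ, Real.exp (N * g x) * p x ∂μ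
      = ∫ u, F N ((√(N : ℝ))⁻¹ • u) ∂μ := by
    intro N
    rw [Measure.integral_comp_inv_smul_of_nonneg μ (F N) (Real.sqrt_nonneg _),
      integral_indicator measurableSet_ball, smul_eq_mul]
  simp_rw [hscale]
  refine tendsto_integral_filter_of_dominated_convergence
    (fun u => Real.exp (-(1 / 2) * q u) * M) ?_ ?_ (hqint.mul_const M) ?_
  · refine Eventually.of_forall fun N => Measurable.aestronglyMeasurable ?_
    have hF : Measurable (F N) := Measurable.indicator (by fun_prop) measurableSet_ball
    exact hF.comp (measurable_const_smul _)
  · filter_upwards [eventually_gt_atTop 0] with N hN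
    have hN' : (0 : ℝ) < N := by exact_mod_cast hN
    refine Eventually.of_forall fun u => ?_
    by_cases hu : (√(N : ℝ))⁻¹ • u ∈ Metric.ball (0 : E) δ
    · simp only [F, Set.indicator_of_mem hu, norm_mul, Real.norm_of_nonneg (Real.exp_nonneg _)]
      refine mul_le_mul (Real.exp_le_exp.2 ?_) (hM _ hu) (norm_nonneg _) (Real.exp_nonneg _)
      · have h := hgle _ hu
        rw [hq, inv_pow, Real.sq_sqrt hN'.le] at h
        calc (N : ℝ) * g ((√(N : ℝ))⁻¹ • u) ≤ N * (-(1 / 2) * ((N : ℝ)⁻¹ * q u)) := by gcongr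
          _ = -(1 / 2) * q u := by field_simp
    · simp only [F, Set.indicator_of_notMem hu, norm_zero]
      positivity
  · refine Eventually.of_forall fun u => ?_
    have h1 := (tendsto_mul_comp_inv_sqrt_smul hq hgq u).rexp.mul ((hp.tendsto 0).comp (hx u))
    refine h1.congr' ?_
    filter_upwards [(hx u).eventually (Metric.ball_mem_nhds 0 hδ)] with N hN
    have hN' : (√(N : ℝ))⁻¹ • u ∈ Metric.ball (0 : E) δ := hN
    simp only [F, Set.indicator_of_mem hN', Function.comp]

theorem tendsto_sqrt_pow_mul_integral_exp_mul {g p q : E → ℝ}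
    (hg : Continuous g) (hp : Continuous p) (hp0 : ∀ x, 0 ≤ p x) (hg0 : ∀ x, g x ≤ 0)
    (hint : Integrable (fun x => Real.exp (g x) * p x) μ)
    (hout : ∀ δ > 0, ∃ c > 0, ∀ x, δ ≤ ‖x‖ → g x ≤ -c)
    (hq : ∀ (t : ℝ) x, q (t • x) = t ^ 2 * q x)
    {k : ℝ} (hk : 0 < k) (hqk : ∀ x, k * ‖x‖ ^ 2 ≤ q x)
    (hgq : (fun x => g x + q x) =o[𝓝 0] fun x => ‖x‖ ^ 2)
    (hqint : Integrable (fun x => Real.exp (-(1 / 2) * q x)) μ) :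
    Tendsto (fun N : ℕ => √(N : ℝ) ^ Module.finrank ℝ E *
      ∫ x, Real.exp (N * g x) * p x ∂μ) atTop (𝓝 (∫ x, Real.exp (-q x) * p 0 ∂μ)) := by
  have hp1 : ∀ᶠ x in 𝓝 (0 : E), ‖p x‖ ≤ ‖p 0‖ + 1 :=
    (hp.norm.tendsto 0).eventually (eventually_le_nhds (by linarith))
  obtain ⟨δ, hδ, hball⟩ := Metric.eventually_nhds_iff_ball.1
    (((Asymptotics.isLittleO_iff.1 hgq) (half_pos hk)).and hp1)
  obtain ⟨c, hc, hcout⟩ := hout δ hδ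
  have hin := tendsto_sqrt_pow_mul_setIntegral_ball (μ := μ) hg hp hq hgq hqint hδ
    (fun x hx => by
      have h := (le_abs_self _).trans (hball x hx).1
      rw [Real.norm_of_nonneg (by positivity)] at h
      linarith [hqk x])
    (fun x hx => (hball x hx).2)
  have hsum := hin.add (tendsto_sqrt_pow_mul_setIntegral_compl_ball hp0 hint hc hcout
    (Module.finrank ℝ E))
  rw [add_zero] at hsum
  refine hsum.congr' ?_
  filter_upwards [eventually_ge_atTop 1] with N hN
  have hN' : (1 : ℝ) ≤ N := by exact_mod_cast hN
  rw [← mul_add, integral_add_compl measurableSet_ball]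
  refine hint.mono' (by fun_prop) (Eventually.of_forall fun x => ?_)
  rw [Real.norm_of_nonneg (mul_nonneg (Real.exp_nonneg _) (hp0 x))]
  refine mul_le_mul_of_nonneg_right (Real.exp_le_exp.2 ?_) (hp0 x)
  nlinarith [hg0 x]

end Laplace

theorem norm_sq_le_dotProduct_self {d : ℕ} (v : Fin d → ℝ) : ‖v‖ ^ 2 ≤ v ⬝ᵥ v := by
  have h0 : 0 ≤ v ⬝ᵥ v := Finset.sum_nonneg fun i _ => mul_self_nonneg (v i)
  refine (Real.le_sqrt (norm_nonneg v) h0).1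
    ((pi_norm_le_iff_of_nonneg (Real.sqrt_nonneg _)).2 fun i => Real.abs_le_sqrt ?_)
  rw [pow_two]
  exact Finset.single_le_sum (f := fun j => v j * v j)
    (fun j _ => mul_self_nonneg (v j)) (Finset.mem_univ i)

theorem Matrix.exists_mul_norm_sq_le_dotProduct_mulVec {d : ℕ} {B : Matrix (Fin d) (Fin d) ℝ}
    (hB : B.det ≠ 0) : ∃ k > 0, ∀ x, k * ‖x‖ ^ 2 ≤ B.mulVec x ⬝ᵥ B.mulVec x := by
  have hinj : LinearMap.ker (Matrix.toLin' B) = ⊥ :=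
    LinearMap.ker_eq_bot.2 (Matrix.mulVec_injective_iff_isUnit.2
      ((Matrix.isUnit_iff_isUnit_det B).2 hB.isUnit))
  obtain ⟨K, hK, hanti⟩ := (Matrix.toLin' B).exists_antilipschitzWith hinj
  have hK' : (0 : ℝ) < K := hK
  refine ⟨((K : ℝ) ^ 2)⁻¹, by positivity, fun x => ?_⟩
  have h : ‖x‖ ≤ K * ‖B.mulVec x‖ := by simpa using hanti.le_mul_dist x 0
  rw [inv_mul_le_iff₀ (by positivity)]
  calc ‖x‖ ^ 2 ≤ (K * ‖B.mulVec x‖) ^ 2 := by gcongr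
    _ = K ^ 2 * ‖B.mulVec x‖ ^ 2 := by ring
    _ ≤ K ^ 2 * (B.mulVec x ⬝ᵥ B.mulVec x) := by
      gcongr
      exact norm_sq_le_dotProduct_self _

theorem ContinuousLinearMap.apply_apply_eq_dotProduct_mulVec {d : ℕ}
    (L : (Fin d → ℝ) →L[ℝ] (Fin d → ℝ) →L[ℝ] ℝ) (H : Matrix (Fin d) (Fin d) ℝ)
    (hH : ∀ i j, H i j = L (Pi.single i 1) (Pi.single j 1)) (x : Fin d → ℝ) :
    L x x = x ⬝ᵥ H.mulVec x := by
  have hx : x = ∑ i, x i • Pi.single i (1 : ℝ) := by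
    simpa [← Pi.single_smul] using (Finset.univ_sum_single x).symm
  have hsum : L x x = ∑ i, x i * ∑ j, x j * L (Pi.single i 1) (Pi.single j 1) := by
    conv_lhs => rw [hx]
    simp only [map_sum, map_smul, sum_apply, smul_apply, smul_eq_mul]
    simp only [Finset.mul_sum]
    rw [Finset.sum_comm]
    exact Finset.sum_congr rfl fun i _ => Finset.sum_congr rfl fun j _ => by ring
  simp only [hsum, dotProduct, Matrix.mulVec, hH, mul_comm]

/-- **Logarithmic form of Laplace's method** used to derive gFIC:
`log ∫ exp (N f) prior dθ − N f(θ̂) + (d/2) log N →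
  (d/2) log (2π) + log (prior θ̂) − (1/2) log det (−H)`,
in particular `log ∫ exp (N f) prior dθ = N f(θ̂) − (d/2) log N + O(1)`. -/
theorem laplace_method_log
    (d : ℕ) (hd : 1 ≤ d)
    (f : (Fin d → ℝ) → ℝ) (θhat : Fin d → ℝ)
    (hconc : ConcaveOn ℝ Set.univ f)
    (hsmooth : ContDiffAt ℝ 2 f θhat)
    (hmax : ∀ θ : Fin d → ℝ, θ ≠ θhat → f θ < f θhat)
    (H : Matrix (Fin d) (Fin d) ℝ)
    (hH : ∀ i j : Fin d,
      H i j = iteratedFDeriv ℝ 2 f θhat ![Pi.single i (1 : ℝ), Pi.single j (1 : ℝ)])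
    (hneg : (-H).PosDef)
    (prior : (Fin d → ℝ) → ℝ)
    (hcont : Continuous prior) (hnonneg : ∀ θ, 0 ≤ prior θ)
    (hpos : 0 < prior θhat)
    (hint : Integrable (fun θ => Real.exp (f θ) * prior θ) volume) :
    Tendsto
      (fun N : ℕ =>
        Real.log (∫ θ : Fin d → ℝ, Real.exp ((N : ℝ) * f θ) * prior θ)
          - (N : ℝ) * f θhat + ((d : ℝ) / 2) * Real.log N)
      atTop
      (𝓝 (((d : ℝ) / 2) * Real.log (2 * Real.pi) + Real.log (prior θhat)
        - (1 / 2) * Real.log ((-H).det))) := by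
  obtain ⟨B, hHB, hB⟩ := hneg.exists_eq_transpose_mul_self
  obtain ⟨k, hk, hBk⟩ := Matrix.exists_mul_norm_sq_le_dotProduct_mulVec hB
  have hfc : Continuous f := continuousOn_univ.1 (hconc.continuousOn isOpen_univ)
  have hle : ∀ θ, f θ ≤ f θhat := fun θ => by
    rcases eq_or_ne θ θhat with rfl | h
    exacts [le_rfl, (hmax θ h).le]
  have hcrit : fderiv ℝ f θhat = 0 :=
    IsLocalMax.fderiv_eq_zero (Eventually.of_forall hle)
  set g : (Fin d → ℝ) → ℝ := fun x => f (θhat + x) - f θhat with hg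
  set q : (Fin d → ℝ) → ℝ := fun x => (1 / 2) * (B.mulVec x ⬝ᵥ B.mulVec x) with hq
  have hgc : Continuous g := by fun_prop
  have hgconc : ConcaveOn ℝ Set.univ g := by
    simpa [hg, Function.comp_def, Pi.add_def, sub_eq_add_neg] using
      (hconc.translate_right θhat).add_const (-f θhat)
  have hgq : (fun x => g x + q x) =o[𝓝 0] fun x => ‖x‖ ^ 2 := by
    refine (isLittleO_second_order_taylor hsmooth hcrit).congr_left fun x => ?_
    have hL := ContinuousLinearMap.apply_apply_eq_dotProduct_mulVec
      (fderiv ℝ (fderiv ℝ f) θhat) H (fun i j => by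
        rw [hH, iteratedFDeriv_two_apply]
        rfl) x
    have hBx : B.mulVec x ⬝ᵥ B.mulVec x = -(x ⬝ᵥ H.mulVec x) := by
      rw [← dotProduct_neg, ← Matrix.neg_mulVec, hHB, ← Matrix.mulVec_mulVec,
        Matrix.dotProduct_mulVec x, Matrix.vecMul_transpose]
    simp only [hg, hq, hL, hBx]
    ring
  have hgauss : ∫ x, Real.exp (-q x) * prior (θhat + 0)
      = |B.det|⁻¹ * √(2 * Real.pi) ^ d * prior θhat := by
    rw [integral_mul_const, add_zero]
    have h := (B.integrable_and_integral_exp_neg_mul_dotProduct_mulVec hB one_half_pos).2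
    rw [show Real.pi / (1 / 2) = 2 * Real.pi by ring] at h
    rw [← h]
    simp only [hq, neg_mul]
  have hlim := tendsto_sqrt_pow_mul_integral_exp_mul (μ := volume) (g := g)
    (p := fun x => prior (θhat + x)) (q := q) hgc (by fun_prop) (fun x => hnonneg _)
    (fun x => sub_nonpos.2 (hle _))
    (by
      refine ((hint.comp_add_left θhat).const_mul (Real.exp (-f θhat))).congr
        (Eventually.of_forall fun x => ?_)
      simp only [hg, sub_eq_neg_add, Real.exp_add]
      ring)
    (fun δ hδ => hgconc.exists_forall_le_neg_of_le_norm hgc (by simp [hg])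
      (fun x hx => sub_neg.2 (hmax _ (by simpa using hx))) hδ)
    (fun t x => by
      simp only [hq, Matrix.mulVec_smul, dotProduct_smul, smul_dotProduct, smul_eq_mul]
      ring)
    (half_pos hk) (fun x => by
      simp only [hq]
      linarith [hBk x])
    hgq
    (by
      refine (B.integrable_and_integral_exp_neg_mul_dotProduct_mulVec hB
        (by norm_num : (0 : ℝ) < 1 / 4)).1.congr (Eventually.of_forall fun x => ?_)
      simp only [hq]
      ring_nf)
  rw [hgauss, Module.finrank_fin_fun] at hlim
  have hdet : 0 < |B.det|⁻¹ := inv_pos.2 (abs_pos.2 hB)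
  have hpi : 0 < √(2 * Real.pi) := by positivity
  have hlog := hlim.log (by positivity)
  have hconst : Real.log (|B.det|⁻¹ * √(2 * Real.pi) ^ d * prior θhat)
      = ((d : ℝ) / 2) * Real.log (2 * Real.pi) + Real.log (prior θhat)
        - (1 / 2) * Real.log ((-H).det) := by
    rw [hHB, Matrix.det_mul, Matrix.det_transpose, Real.log_mul hB hB,
      Real.log_mul (by positivity) hpos.ne', Real.log_mul hdet.ne' (by positivity),
      Real.log_inv, Real.log_abs, Real.log_pow, Real.log_sqrt (by positivity)]
    ring
  rw [hconst] at hlog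
  refine hlog.congr' ?_
  filter_upwards [hlim.eventually_const_lt
    (show 0 < |B.det|⁻¹ * √(2 * Real.pi) ^ d * prior θhat by positivity),
    eventually_gt_atTop 0] with N hN hN0
  have hN' : (0 : ℝ) < N := by exact_mod_cast hN0
  have hK := pos_of_mul_pos_right hN (by positivity)
  have hI : ∫ θ : Fin d → ℝ, Real.exp (N * f θ) * prior θ
      = Real.exp (N * f θhat) * ∫ x, Real.exp (N * g x) * prior (θhat + x) := by
    rw [← integral_add_left_eq_self _ θhat, ← integral_const_mul]
    refine integral_congr_ae (Eventually.of_forall fun x => ?_)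
    simp only [hg]
    rw [← mul_assoc, ← Real.exp_add]
    ring_nf
  rw [hI, Real.log_mul (by positivity) hK.ne', Real.log_mul (Real.exp_ne_zero _) hK.ne',
    Real.log_exp, Real.log_pow, Real.log_sqrt hN'.le]
  ring
end

section
/- Let X be an n×d real matrix, Z an n×k real matrix, and W a d×k real matrix, and suppose the rank of Z equals r with r < k. Then there exist an n×r real matrix Z' and a d×r real matrix W' such that ‖X − Z'·W'ᵀ‖_F² = ‖X − Z·Wᵀ‖_F², ‖Z'‖_F² = ‖Z‖_F², and the rank of Z' equals r. Consequently, −(λ/2)‖X − Z'W'ᵀ‖_F² − (1/2)‖Z'‖_F² = −(λ/2)‖X − ZWᵀ‖_F² − (1/2)‖Z‖_F² for every real λ. -/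
open Matrix

/-- Squared Frobenius norm `‖A‖_F² = ∑_{ij} A_{ij}²`. -/
def frobSq {m p : Type*} [Fintype m] [Fintype p] (A : Matrix m p ℝ) : ℝ :=
  ∑ i, ∑ j, (A i j) ^ 2

/-- A real matrix of rank `r` has an orthonormal basis of its row space as the columns of some
`V` with `r` columns, so that right multiplication by the projection `V * Vᵀ` fixes the matrix. -/
theorem Matrix.exists_mul_mul_transpose_eq_self {m : Type*} [Finite m] {k r : ℕ}
    (Z : Matrix m (Fin k) ℝ) (hrank : Z.rank = r) :
    ∃ V : Matrix (Fin k) (Fin r) ℝ, Z * V * Vᵀ = Z := by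
  let e := (WithLp.linearEquiv 2 ℝ (Fin k → ℝ)).symm
  let S := (Submodule.span ℝ (Set.range Z.row)).map e.toLinearMap
  have hS : Module.finrank ℝ S = r := by
    rw [← hrank, rank_eq_finrank_span_row]
    exact LinearEquiv.finrank_map_eq e _
  let b := (stdOrthonormalBasis ℝ S).reindex (finCongr hS)
  refine ⟨Matrix.of fun l j => (b j : EuclideanSpace ℝ (Fin k)) l, ?_⟩
  ext i l
  have hi : e (Z.row i) ∈ S :=
    Submodule.mem_map_of_mem (Submodule.subset_span (Set.mem_range_self i))
  have h := congrArg (fun x : S => (x : EuclideanSpace ℝ (Fin k)) l) (b.sum_repr' ⟨_, hi⟩)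
  simpa [Matrix.mul_apply, PiLp.inner_apply, e, Matrix.row] using h

theorem frobSq_eq_trace {m p : Type*} [Fintype m] [Fintype p] (A : Matrix m p ℝ) :
    frobSq A = (A * Aᵀ).trace := by
  simp [frobSq, Matrix.trace, Matrix.mul_apply, sq]

/-- **Degeneration removal for BPCA**: if `rank Z = r < k`, then there exist a
non-degenerated latent matrix `Z'` of size `n × r` and a basis `W'` of size
`d × r` preserving the reconstruction error, the latent norm, and hence the
BPCA log joint likelihood for every noise precision `λ`. -/
theorem bpca_degeneration_removal
    (n d k r : ℕ)
    (X : Matrix (Fin n) (Fin d) ℝ)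
    (Z : Matrix (Fin n) (Fin k) ℝ)
    (W : Matrix (Fin d) (Fin k) ℝ)
    (hrank : Z.rank = r) (hr : r < k) :
    ∃ (Z' : Matrix (Fin n) (Fin r) ℝ) (W' : Matrix (Fin d) (Fin r) ℝ),
      frobSq (X - Z' * W'ᵀ) = frobSq (X - Z * Wᵀ)
        ∧ frobSq Z' = frobSq Z
        ∧ Z'.rank = r
        ∧ ∀ lam : ℝ,
            -(lam / 2) * frobSq (X - Z' * W'ᵀ) - (1 / 2) * frobSq Z'
              = -(lam / 2) * frobSq (X - Z * Wᵀ) - (1 / 2) * frobSq Z := by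
  obtain ⟨V, hV⟩ := Z.exists_mul_mul_transpose_eq_self hrank
  have hprod : Z * V * (W * V)ᵀ = Z * Wᵀ := by
    rw [transpose_mul, ← Matrix.mul_assoc, hV]
  have hnorm : frobSq (Z * V) = frobSq Z := by
    rw [frobSq_eq_trace, frobSq_eq_trace, transpose_mul, ← Matrix.mul_assoc, hV]
  have hle : r ≤ (Z * V).rank := by
    calc r = (Z * V * Vᵀ).rank := by rw [hV, hrank]
      _ ≤ (Z * V).rank := rank_mul_le_left _ _
  refine ⟨Z * V, W * V, by rw [hprod], hnorm, le_antisymm ?_ hle, fun lam => by rw [hprod, hnorm]⟩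
  exact rank_le_width _
end
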